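/- arXiv:2412.01318 — 2 statements merged into one kernel-verified Lean document; each statement's English description precedes it below -/
import Mathlib

section
/- Let σ = 1 and n ∈ {1,2}. Let ℓ1 = ℓ2 be nonzero reals, β1, β2 > 0 with β1 ≠ β2, and c1, c2 > 0 with c1 ≠ c2. Then there exists C > 0 such that for all t > 0: I(t;1) ≤ C·(1+t)³ when n = 1, and I(t;2) ≤ C·(1+t)²·log(e+t) when n = 2. -/
open MeasureTheory Real

/-- The double diffusion waves integral `I(t;n)` with singularity parameter `σ`. -/
noncomputable def ddwIntegral (ℓ1 ℓ2 β1 β2 c1 c2 ε0 : ℝ) (σ n : ℕ) (t : ℝ) : ℝ :=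
  ∫ r in Set.Ioc (0 : ℝ) ε0,
    |ℓ1 * (Real.sin (β1 * r * t) / (β1 * r)) * Real.exp (-(c1 * r ^ 2 * t))
      - ℓ2 * (Real.sin (β2 * r * t) / (β2 * r)) * Real.exp (-(c2 * r ^ 2 * t))| ^ 2
      * r ^ ((n : ℝ) - 1 - 2 * (σ : ℝ))

lemma sub_sin_le_two_mul_sq {x : ℝ} (hx : 0 < x) : x - sin x ≤ 2 * x ^ 2 := by
  rcases le_total x 1 with h | h
  · have := sin_gt_sub_cube hx
    nlinarith [mul_nonneg (sq_nonneg x) (sub_nonneg.2 h)]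
  · nlinarith [neg_one_le_sin x]

/-- The kernel of a single diffusion wave is at most `t`. -/
lemma abs_diffusionWave_le {β c r t : ℝ} (hβ : 0 < β) (hc : 0 < c) (hr : 0 < r) (ht : 0 < t) :
    |sin (β * r * t) / (β * r) * exp (-(c * r ^ 2 * t))| ≤ t := by
  have hs : |sin (β * r * t)| ≤ t * (β * r) := by
    refine abs_sin_le_abs.trans_eq ?_
    rw [abs_of_pos (by positivity)]
    ring
  have he : exp (-(c * r ^ 2 * t)) ≤ 1 := exp_le_one_iff.2 (neg_nonpos.2 (by positivity))
  rw [abs_mul, abs_div, abs_of_pos (mul_pos hβ hr), abs_exp]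
  calc _ ≤ t * 1 := by
        gcongr
        exact (div_le_iff₀ (mul_pos hβ hr)).2 hs
    _ = t := mul_one t

/-- For low frequencies the kernel of a single diffusion wave is close to `t`. -/
lemma abs_diffusionWave_sub_le {β c r t : ℝ} (hβ : 0 < β) (hc : 0 < c) (hr : 0 < r)
    (ht : 0 < t) :
    |sin (β * r * t) / (β * r) * exp (-(c * r ^ 2 * t)) - t|
      ≤ (2 * β + c * r) * r * t ^ 2 := by
  have hβr : 0 < β * r := mul_pos hβ hr
  have hx : 0 < β * r * t := mul_pos hβr ht
  have hs : sin (β * r * t) / (β * r) ≤ t := by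
    rw [div_le_iff₀ hβr]
    linarith [sin_le hx.le]
  have hs' : t - 2 * β * r * t ^ 2 ≤ sin (β * r * t) / (β * r) := by
    rw [le_div_iff₀ hβr]
    linarith [sub_sin_le_two_mul_sq hx]
  have he : exp (-(c * r ^ 2 * t)) ≤ 1 := exp_le_one_iff.2 (neg_nonpos.2 (by positivity))
  have he' : 1 - c * r ^ 2 * t ≤ exp (-(c * r ^ 2 * t)) := by
    linarith [add_one_le_exp (-(c * r ^ 2 * t))]
  have hE := exp_pos (-(c * r ^ 2 * t))
  have h0 : 0 ≤ 2 * β * r * t ^ 2 := by positivity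
  have h1 : 0 ≤ c * r ^ 2 * t ^ 2 := by positivity
  rw [abs_le]
  constructor
  · nlinarith [mul_le_mul_of_nonneg_right hs' hE.le, mul_le_mul_of_nonneg_left he' ht.le,
      mul_le_mul_of_nonneg_left he h0]
  · nlinarith [mul_le_mul_of_nonneg_right hs hE.le, mul_le_mul_of_nonneg_left he ht.le]

/-- A bound for the difference of two diffusion waves with equal amplitudes, covering both the
regime `r * (1 + t) ≤ 1` and its complement. -/
lemma sq_abs_diffusionWave_sub_le {ℓ β1 β2 c1 c2 ε0 r t : ℝ} (hβ1 : 0 < β1) (hβ2 : 0 < β2)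
    (hc1 : 0 < c1) (hc2 : 0 < c2) (hr : 0 < r) (hrε : r ≤ ε0) (ht : 0 < t) :
    |ℓ * (sin (β1 * r * t) / (β1 * r)) * exp (-(c1 * r ^ 2 * t))
      - ℓ * (sin (β2 * r * t) / (β2 * r)) * exp (-(c2 * r ^ 2 * t))| ^ 2
      ≤ 2 * (|ℓ| * (2 + 2 * β1 + 2 * β2 + (c1 + c2) * ε0)) ^ 2 * (1 + t) ^ 4 * r ^ 2
        * (1 + (r * (1 + t)) ^ 2)⁻¹ := by
  have hε : 0 < ε0 := hr.trans_le hrε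
  set a := sin (β1 * r * t) / (β1 * r) * exp (-(c1 * r ^ 2 * t)) with ha
  set b := sin (β2 * r * t) / (β2 * r) * exp (-(c2 * r ^ 2 * t)) with hb
  set B := 2 + 2 * β1 + 2 * β2 + (c1 + c2) * ε0
  have hcε : 0 < (c1 + c2) * ε0 := by positivity
  have hB2 : 2 ≤ B := by linarith
  have heq : |ℓ * (sin (β1 * r * t) / (β1 * r)) * exp (-(c1 * r ^ 2 * t))
      - ℓ * (sin (β2 * r * t) / (β2 * r)) * exp (-(c2 * r ^ 2 * t))| = |ℓ| * |a - b| := by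
    rw [← abs_mul, ha, hb]
    ring_nf
  have hhigh : |a - b| ≤ B * (1 + t) := by
    calc |a - b| ≤ |a| + |b| := abs_sub a b
      _ ≤ t + t := add_le_add (abs_diffusionWave_le hβ1 hc1 hr ht)
          (abs_diffusionWave_le hβ2 hc2 hr ht)
      _ ≤ B * (1 + t) := by nlinarith
  have hlow : |a - b| ≤ B * (r * (1 + t) ^ 2) := by
    calc |a - b| ≤ |a - t| + |b - t| := by
          rw [abs_sub_comm b t]
          exact abs_sub_le a t b
      _ ≤ (2 * β1 + c1 * r) * r * t ^ 2 + (2 * β2 + c2 * r) * r * t ^ 2 :=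
          add_le_add (abs_diffusionWave_sub_le hβ1 hc1 hr ht)
            (abs_diffusionWave_sub_le hβ2 hc2 hr ht)
      _ = (2 * β1 + 2 * β2 + (c1 + c2) * r) * (r * t ^ 2) := by ring
      _ ≤ (2 * β1 + 2 * β2 + (c1 + c2) * ε0) * (r * (1 + t) ^ 2) := by
          gcongr
          linarith
      _ ≤ B * (r * (1 + t) ^ 2) := by
          gcongr
          linarith
  have hhigh2 : |a - b| ^ 2 * (r * (1 + t)) ^ 2 ≤ (B * (1 + t)) ^ 2 * (r * (1 + t)) ^ 2 := by
    gcongr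
  have hlow2 : |a - b| ^ 2 ≤ (B * (r * (1 + t) ^ 2)) ^ 2 := by gcongr
  rw [heq, ← div_eq_mul_inv, le_div_iff₀ (by positivity)]
  calc (|ℓ| * |a - b|) ^ 2 * (1 + (r * (1 + t)) ^ 2)
      = |ℓ| ^ 2 * (|a - b| ^ 2 + |a - b| ^ 2 * (r * (1 + t)) ^ 2) := by ring
    _ ≤ |ℓ| ^ 2 * ((B * (r * (1 + t) ^ 2)) ^ 2 + (B * (1 + t)) ^ 2 * (r * (1 + t)) ^ 2) := by
        gcongr
    _ = 2 * (|ℓ| * B) ^ 2 * (1 + t) ^ 4 * r ^ 2 := by ring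

lemma ddwIntegral_le_of_le {ℓ1 ℓ2 β1 β2 c1 c2 ε0 t : ℝ} {σ n : ℕ} {f F : ℝ → ℝ} (hε0 : 0 < ε0)
    (hf : Continuous f) (hF : ∀ r, HasDerivAt F (f r) r)
    (hle : ∀ r, 0 < r → r ≤ ε0 →
      |ℓ1 * (sin (β1 * r * t) / (β1 * r)) * exp (-(c1 * r ^ 2 * t))
        - ℓ2 * (sin (β2 * r * t) / (β2 * r)) * exp (-(c2 * r ^ 2 * t))| ^ 2
        * r ^ ((n : ℝ) - 1 - 2 * (σ : ℝ)) ≤ f r) :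
    ddwIntegral ℓ1 ℓ2 β1 β2 c1 c2 ε0 σ n t ≤ F ε0 - F 0 := by
  rw [← intervalIntegral.integral_eq_sub_of_hasDerivAt (fun r _ => hF r)
    (hf.intervalIntegrable 0 ε0), intervalIntegral.integral_of_le hε0.le]
  refine integral_mono_of_nonneg ?_ (hf.intervalIntegrable 0 ε0).1 ?_
  · filter_upwards [ae_restrict_mem measurableSet_Ioc] with r hr
    exact mul_nonneg (sq_nonneg _) (rpow_nonneg hr.1.le _)
  · filter_upwards [ae_restrict_mem measurableSet_Ioc] with r hr
    exact hle r hr.1 hr.2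

lemma log_one_add_sq_le {ε0 t : ℝ} (ht : 0 < t) :
    log (1 + (ε0 * (1 + t)) ^ 2) ≤ (log (1 + ε0 ^ 2) + 2) * log (exp 1 + t) := by
  have he : 1 ≤ exp 1 := one_le_exp zero_le_one
  have hL : 1 ≤ log (exp 1 + t) := by
    rw [le_log_iff_exp_le (by positivity)]
    linarith
  have hε : 0 ≤ log (1 + ε0 ^ 2) := log_nonneg (by nlinarith [sq_nonneg ε0])
  have hT : log (1 + t) ≤ log (exp 1 + t) := log_le_log (by positivity) (by linarith)
  calc log (1 + (ε0 * (1 + t)) ^ 2) ≤ log ((1 + ε0 ^ 2) * (1 + t) ^ 2) :=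
        log_le_log (by positivity) (by nlinarith)
    _ = log (1 + ε0 ^ 2) + 2 * log (1 + t) := by
        rw [log_mul (by positivity) (by positivity), log_pow]
        norm_num
    _ ≤ (log (1 + ε0 ^ 2) + 2) * log (exp 1 + t) := by nlinarith

theorem ddw_very_low_dim_distinct_speeds_upper
    (ℓ β1 β2 c1 c2 ε0 : ℝ) (hℓ : ℓ ≠ 0) (hβ1 : 0 < β1) (hβ2 : 0 < β2)
    (hβ : β1 ≠ β2) (hc1 : 0 < c1) (hc2 : 0 < c2) (hc : c1 ≠ c2) (hε0 : 0 < ε0) :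
    ∃ C > 0, ∀ t > 0,
      ddwIntegral ℓ ℓ β1 β2 c1 c2 ε0 1 1 t ≤ C * (1 + t) ^ 3
        ∧ ddwIntegral ℓ ℓ β1 β2 c1 c2 ε0 1 2 t
            ≤ C * (1 + t) ^ 2 * Real.log (Real.exp 1 + t) := by
  set K := 2 * (|ℓ| * (2 + 2 * β1 + 2 * β2 + (c1 + c2) * ε0)) ^ 2
  have hK : 0 < K := by positivity
  have hlogε : 0 ≤ log (1 + ε0 ^ 2) := log_nonneg (by nlinarith [sq_nonneg ε0])
  refine ⟨K * (π / 2 + (log (1 + ε0 ^ 2) + 2) / 2), by positivity, fun t ht => ⟨?_, ?_⟩⟩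
  · have hderiv (r : ℝ) : HasDerivAt (fun r => K * (1 + t) ^ 3 * arctan (r * (1 + t)))
        (K * (1 + t) ^ 4 * (1 + (r * (1 + t)) ^ 2)⁻¹) r := by
      refine ((((hasDerivAt_id' r).mul_const (1 + t)).arctan).const_mul
        (K * (1 + t) ^ 3)).congr_deriv ?_
      ring
    have hcont : Continuous fun r : ℝ => K * (1 + t) ^ 4 * (1 + (r * (1 + t)) ^ 2)⁻¹ :=
      continuous_const.mul (Continuous.inv₀ (by fun_prop) fun r => by positivity)
    refine (ddwIntegral_le_of_le hε0 hcont hderiv fun r hr hrε => ?_).trans ?_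
    · have hexp : ((1 : ℕ) : ℝ) - 1 - 2 * ((1 : ℕ) : ℝ) = -(2 : ℕ) := by norm_num
      rw [hexp, rpow_neg hr.le, rpow_natCast, ← div_eq_mul_inv, div_le_iff₀ (by positivity)]
      refine (sq_abs_diffusionWave_sub_le hβ1 hβ2 hc1 hc2 hr hrε ht).trans_eq ?_
      ring
    · simp only [zero_mul, arctan_zero, mul_zero, sub_zero]
      calc K * (1 + t) ^ 3 * arctan (ε0 * (1 + t)) ≤ K * (1 + t) ^ 3 * (π / 2) := by
            gcongr
            exact (arctan_lt_pi_div_two _).le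
        _ = K * (π / 2) * (1 + t) ^ 3 := by ring
        _ ≤ _ := by
            gcongr
            linarith
  · have hderiv (r : ℝ) : HasDerivAt
        (fun r => K * (1 + t) ^ 2 / 2 * log (1 + (r * (1 + t)) ^ 2))
        (K * (1 + t) ^ 4 * r * (1 + (r * (1 + t)) ^ 2)⁻¹) r := by
      have hne : 1 + (r * (1 + t)) ^ 2 ≠ 0 := by positivity
      refine ((((((hasDerivAt_id' r).mul_const (1 + t)).fun_pow 2).const_add 1).log
        hne).const_mul (K * (1 + t) ^ 2 / 2)).congr_deriv ?_
      push_cast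
      ring
    have hcont : Continuous fun r : ℝ => K * (1 + t) ^ 4 * r * (1 + (r * (1 + t)) ^ 2)⁻¹ :=
      (continuous_const.mul continuous_id).mul
        (Continuous.inv₀ (by fun_prop) fun r => by positivity)
    refine (ddwIntegral_le_of_le hε0 hcont hderiv fun r hr hrε => ?_).trans ?_
    · have hexp : ((2 : ℕ) : ℝ) - 1 - 2 * ((1 : ℕ) : ℝ) = -1 := by norm_num
      rw [hexp, rpow_neg_one, ← div_eq_mul_inv, div_le_iff₀ hr]
      refine (sq_abs_diffusionWave_sub_le hβ1 hβ2 hc1 hc2 hr hrε ht).trans_eq ?_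
      ring
    · have hlog : 0 ≤ log (exp 1 + t) :=
        log_nonneg (by linarith [one_le_exp (zero_le_one (α := ℝ))])
      simp only [zero_mul, ne_eq, OfNat.ofNat_ne_zero, not_false_eq_true, zero_pow, add_zero,
        log_one, mul_zero, sub_zero]
      calc K * (1 + t) ^ 2 / 2 * log (1 + (ε0 * (1 + t)) ^ 2)
          ≤ K * (1 + t) ^ 2 / 2 * ((log (1 + ε0 ^ 2) + 2) * log (exp 1 + t)) := by
            gcongr
            exact log_one_add_sq_le ht
        _ = K * ((log (1 + ε0 ^ 2) + 2) / 2) * (1 + t) ^ 2 * log (exp 1 + t) := by ring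
        _ ≤ _ := by
            gcongr
            linarith [pi_pos]
end

section
/- Let σ = 1 and n = 3. Let ℓ1 = ℓ2 be nonzero reals, β1, β2 > 0 with β1 ≠ β2, and c1, c2 > 0 with c1 ≠ c2, and let ε0 > 0. Then there exist constants c > 0 and T > 0 such that I(t;3) ≥ c·t for all t ≥ T. -/
open MeasureTheory Real

/-- Two dilations of `sinc` by different positive factors disagree at some positive point. -/
theorem exists_pos_sinc_mul_ne {a b : ℝ} (ha : 0 < a) (hb : 0 < b) (hab : a ≠ b) :
    ∃ s > 0, sinc (a * s) ≠ sinc (b * s) := by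
  wlog hlt : a < b generalizing a b
  · obtain ⟨s, hs, h⟩ := this hb ha hab.symm (lt_of_le_of_ne (not_lt.mp hlt) hab.symm)
    exact ⟨s, hs, h.symm⟩
  have hs : 0 < π / b := div_pos pi_pos hb
  refine ⟨π / b, hs, ?_⟩
  have hpos : 0 < a * (π / b) := mul_pos ha hs
  have hb_mul : b * (π / b) = π := mul_div_cancel₀ π hb.ne'
  have hltπ : a * (π / b) < π := by
    calc a * (π / b) < b * (π / b) := mul_lt_mul_of_pos_right hlt hs
      _ = π := hb_mul
  rw [hb_mul, sinc_of_ne_zero hpos.ne', sinc_of_ne_zero pi_ne_zero, sin_pi, zero_div]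
  exact (div_pos (sin_pos_of_pos_of_lt_pi hpos hltπ) hpos).ne'

theorem sin_mul_div_eq_mul_sinc {β r t : ℝ} (hβ : β ≠ 0) (hr : r ≠ 0) (ht : t ≠ 0) :
    sin (β * r * t) / (β * r) = t * sinc (β * (r * t)) := by
  rw [← mul_assoc, sinc_of_ne_zero (mul_ne_zero (mul_ne_zero hβ hr) ht)]
  field_simp

/-- The difference of two diffusion wave profiles in the self-similar variable `s = r t`,
with `u = 1 / t`. -/
noncomputable def ddwProfile (β1 β2 c1 c2 s u : ℝ) : ℝ :=
  sinc (β1 * s) * exp (-(c1 * s ^ 2 * u)) - sinc (β2 * s) * exp (-(c2 * s ^ 2 * u))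

theorem continuous_ddwProfile (β1 β2 c1 c2 : ℝ) :
    Continuous fun p : ℝ × ℝ => ddwProfile β1 β2 c1 c2 p.1 p.2 := by
  unfold ddwProfile
  have h := continuous_sinc
  fun_prop

theorem ddwIntegral_eq_integral_ddwProfile {ℓ β1 β2 c1 c2 ε0 t : ℝ} (hβ1 : 0 < β1)
    (hβ2 : 0 < β2) (ht : 0 < t) :
    ddwIntegral ℓ ℓ β1 β2 c1 c2 ε0 1 3 t =
      ∫ r in Set.Ioc 0 ε0, (ℓ * t * ddwProfile β1 β2 c1 c2 (r * t) t⁻¹) ^ 2 := by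
  refine setIntegral_congr_fun measurableSet_Ioc fun r hr => ?_
  have hr0 : r ≠ 0 := hr.1.ne'
  have hexp : ((3 : ℕ) : ℝ) - 1 - 2 * ((1 : ℕ) : ℝ) = 0 := by norm_num
  have hu (c : ℝ) : c * (r * t) ^ 2 * t⁻¹ = c * r ^ 2 * t := by field_simp
  simp only [hexp, rpow_zero, mul_one, sq_abs, ddwProfile, hu,
    sin_mul_div_eq_mul_sinc hβ1.ne' hr0 ht.ne', sin_mul_div_eq_mul_sinc hβ2.ne' hr0 ht.ne']
  ring

/-- The profile difference stays away from zero near some point `(s, 0)` with `s > 0`. -/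
theorem exists_ddwProfile_abs_ge {β1 β2 : ℝ} (c1 c2 : ℝ) (hβ1 : 0 < β1) (hβ2 : 0 < β2)
    (hβ : β1 ≠ β2) :
    ∃ a b δ η : ℝ, 0 < a ∧ a < b ∧ 0 < δ ∧ 0 < η ∧
      ∀ s ∈ Set.Icc a b, ∀ u, 0 ≤ u → u < η → δ ≤ |ddwProfile β1 β2 c1 c2 s u| := by
  obtain ⟨s₀, hs₀, hne⟩ := exists_pos_sinc_mul_ne hβ1 hβ2 hβ
  have hpos : 0 < |ddwProfile β1 β2 c1 c2 s₀ 0| := by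
    simpa [ddwProfile, sub_eq_zero] using hne
  have hev := ((continuous_ddwProfile β1 β2 c1 c2).abs.continuousAt (x := (s₀, 0))).eventually
    (lt_mem_nhds (half_lt_self hpos))
  obtain ⟨η, hη, hball⟩ := Metric.eventually_nhds_iff.mp hev
  refine ⟨s₀, s₀ + η / 2, |ddwProfile β1 β2 c1 c2 s₀ 0| / 2, η, hs₀, by linarith,
    half_pos hpos, hη, fun s hs u hu hu' => (hball (y := (s, u)) ?_).le⟩
  rw [Prod.dist_eq, max_lt_iff, Real.dist_eq, Real.dist_eq, sub_zero, abs_of_nonneg hu,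
    abs_of_nonneg (sub_nonneg.mpr hs.1)]
  exact ⟨by linarith [hs.2], hu'⟩

theorem ddw_lower_bound_3d_equal_amplitudes
    (ℓ β1 β2 c1 c2 ε0 : ℝ) (hℓ : ℓ ≠ 0) (hβ1 : 0 < β1) (hβ2 : 0 < β2)
    (hβ : β1 ≠ β2) (hc1 : 0 < c1) (hc2 : 0 < c2) (hc : c1 ≠ c2) (hε0 : 0 < ε0) :
    ∃ c > 0, ∃ T > 0, ∀ t ≥ T,
      c * t ≤ ddwIntegral ℓ ℓ β1 β2 c1 c2 ε0 1 3 t := by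
  obtain ⟨a, b, δ, η, ha, hab, hδ, hη, hprof⟩ := exists_ddwProfile_abs_ge c1 c2 hβ1 hβ2 hβ
  have hba : 0 < b - a := sub_pos.mpr hab
  have hb : 0 < b := ha.trans hab
  refine ⟨ℓ ^ 2 * δ ^ 2 * (b - a), by positivity, b / ε0 + η⁻¹ + 1, by positivity,
    fun t ht => ?_⟩
  have hbε : 0 < b / ε0 := div_pos hb hε0
  have hη' : 0 < η⁻¹ := inv_pos.mpr hη
  have ht0 : 0 < t := by linarith
  have hu : t⁻¹ < η := inv_lt_of_inv_lt₀ hη (by linarith)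
  have hbt : b / t ≤ ε0 := by
    rw [div_le_iff₀ ht0, ← div_le_iff₀' hε0]
    linarith
  rw [ddwIntegral_eq_integral_ddwProfile hβ1 hβ2 ht0]
  have hcont : Continuous fun r => (ℓ * t * ddwProfile β1 β2 c1 c2 (r * t) t⁻¹) ^ 2 :=
    (continuous_const.mul ((continuous_ddwProfile β1 β2 c1 c2).comp
      ((continuous_id.mul continuous_const).prodMk continuous_const))).pow 2
  have hsub : Set.Ioc (a / t) (b / t) ⊆ Set.Ioc 0 ε0 :=
    Set.Ioc_subset_Ioc (div_pos ha ht0).le hbt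
  have hlen : a / t ≤ b / t := by gcongr
  calc ℓ ^ 2 * δ ^ 2 * (b - a) * t
      = ∫ _ in Set.Ioc (a / t) (b / t), (ℓ * t * δ) ^ 2 := by
        rw [setIntegral_const, Real.volume_real_Ioc_of_le hlen, smul_eq_mul]
        field_simp
    _ ≤ ∫ r in Set.Ioc (a / t) (b / t), (ℓ * t * ddwProfile β1 β2 c1 c2 (r * t) t⁻¹) ^ 2 := by
        refine setIntegral_mono_on continuous_const.integrableOn_Ioc hcont.integrableOn_Ioc
          measurableSet_Ioc fun r hr => ?_
        have hδr := hprof (r * t) ⟨((div_lt_iff₀ ht0).mp hr.1).le, (le_div_iff₀ ht0).mp hr.2⟩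
          t⁻¹ (inv_pos.mpr ht0).le hu
        rw [mul_pow, mul_pow _ (ddwProfile _ _ _ _ _ _), ← sq_abs (ddwProfile _ _ _ _ _ _)]
        gcongr
    _ ≤ ∫ r in Set.Ioc 0 ε0, (ℓ * t * ddwProfile β1 β2 c1 c2 (r * t) t⁻¹) ^ 2 :=
        setIntegral_mono_set hcont.integrableOn_Ioc
          (Filter.Eventually.of_forall fun _ => sq_nonneg _) hsub.eventuallyLE
end
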